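/- arXiv:1512.08261 — 2 statements merged into one kernel-verified Lean document; each statement's English description precedes it below -/
import Mathlib

section
/- If F(x,y) = (a x² + 2b x y + c y²)/2 + (d x + e y)/2 + f is a quadratic packing polynomial on ℕ², then a = b = c = 1. -/
/-- The polynomial `a x² + 2 b x y + c y² + d x + e y` over `ℤ`. -/
def quadPoly (a b c d e x y : ℤ) : ℤ :=
  a * x ^ 2 + 2 * b * x * y + c * y ^ 2 + d * x + e * y

/-- `quadPoly` is injective on the integer points of the first quadrant. -/
def QuadInjective (a b c d e : ℤ) : Prop :=
  ∀ x y x' y' : ℤ, 0 ≤ x → 0 ≤ y → 0 ≤ x' → 0 ≤ y' →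
    quadPoly a b c d e x y = quadPoly a b c d e x' y' → x = x' ∧ y = y'

theorem QuadInjective.swap {a b c d e : ℤ} (h : QuadInjective a b c d e) :
    QuadInjective c b a e d := by
  intro x y x' y' hx hy hx' hy' hxy
  refine (h y x y' x' hy hx hy' hx' ?_).symm
  simp only [quadPoly] at hxy ⊢
  linarith

/-- With `g` the gradient at a point `p` and `u` the adjugate matrix applied to `g`, the points
`p + k u + J g` and `p + k u - J g` have the same value, where `J` is the quarter turn. -/
theorem quadPoly_reflect (a b c d e k x y : ℤ) :
    quadPoly a b c d e
      (x + k * (2 * (a * c - b ^ 2) * x + (c * d - b * e)) + (2 * b * x + 2 * c * y + e))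
      (y + k * (2 * (a * c - b ^ 2) * y + (a * e - b * d)) - (2 * a * x + 2 * b * y + d)) =
    quadPoly a b c d e
      (x + k * (2 * (a * c - b ^ 2) * x + (c * d - b * e)) - (2 * b * x + 2 * c * y + e))
      (y + k * (2 * (a * c - b ^ 2) * y + (a * e - b * d)) + (2 * a * x + 2 * b * y + d)) := by
  simp only [quadPoly]
  ring

theorem one_le_mul_two_mul_add {δ : ℤ} (hδ : δ ≠ 0) (w : ℤ) :
    1 ≤ δ * (2 * δ * (|w| + 1) + w) := by
  have h1 : 1 ≤ |δ| := Int.one_le_abs hδ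
  have h2 : -(|δ| * |w|) ≤ δ * w := by rw [← abs_mul]; exact neg_abs_le _
  have h3 : δ * δ = |δ| * |δ| := (abs_mul_abs_self δ).symm
  have h4 : δ * (2 * δ * (|w| + 1) + w) = 2 * (|δ| * |δ|) * (|w| + 1) + δ * w := by
    rw [← h3]; ring
  have h5 : |δ| ≤ |δ| * |δ| := le_mul_of_one_le_left (abs_nonneg δ) h1
  have h6 := mul_le_mul_of_nonneg_right h5 (abs_nonneg w)
  have h7 : 0 ≤ |δ| * |w| := by positivity
  nlinarith

theorem QuadInjective.mul_eq_sq {a b c d e : ℤ} (h : QuadInjective a b c d e) :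
    a * c = b ^ 2 := by
  by_contra hne
  obtain ⟨δ, hδ⟩ : ∃ δ, δ = a * c - b ^ 2 := ⟨_, rfl⟩
  have hδ0 : δ ≠ 0 := by rw [hδ]; exact sub_ne_zero.mpr hne
  obtain ⟨x, hx⟩ : ∃ x, x = |c * d - b * e| + 1 := ⟨_, rfl⟩
  obtain ⟨y, hy⟩ : ∃ y, y = |a * e - b * d| + 1 := ⟨_, rfl⟩
  obtain ⟨g₁, hg₁⟩ : ∃ g, g = 2 * a * x + 2 * b * y + d := ⟨_, rfl⟩
  obtain ⟨g₂, hg₂⟩ : ∃ g, g = 2 * b * x + 2 * c * y + e := ⟨_, rfl⟩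
  obtain ⟨u₁, hu₁⟩ : ∃ u, u = 2 * δ * x + (c * d - b * e) := ⟨_, rfl⟩
  obtain ⟨u₂, hu₂⟩ : ∃ u, u = 2 * δ * y + (a * e - b * d) := ⟨_, rfl⟩
  have hx0 : 0 ≤ x := by rw [hx]; positivity
  have hy0 : 0 ≤ y := by rw [hy]; positivity
  have h1 : 1 ≤ δ * u₁ := by rw [hu₁, hx]; exact one_le_mul_two_mul_add hδ0 _
  have h2 : 1 ≤ δ * u₂ := by rw [hu₂, hy]; exact one_le_mul_two_mul_add hδ0 _
  have key := quadPoly_reflect a b c d e ((|g₁| + |g₂|) * δ) x y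
  rw [← hδ, ← hg₁, ← hg₂, ← hu₁, ← hu₂] at key
  have hs : 0 ≤ |g₁| + |g₂| := by positivity
  have k1 : |g₁| + |g₂| ≤ (|g₁| + |g₂|) * δ * u₁ := by
    rw [mul_assoc]; exact le_mul_of_one_le_right hs h1
  have k2 : |g₁| + |g₂| ≤ (|g₁| + |g₂|) * δ * u₂ := by
    rw [mul_assoc]; exact le_mul_of_one_le_right hs h2
  have b1 := le_abs_self g₁
  have b2 := neg_abs_le g₁
  have b3 := le_abs_self g₂
  have b4 := neg_abs_le g₂
  obtain ⟨e1, e2⟩ := h _ _ _ _ (by linarith [abs_nonneg g₁]) (by linarith [abs_nonneg g₂])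
    (by linarith [abs_nonneg g₁]) (by linarith [abs_nonneg g₂]) key
  have z1 : g₁ = 0 := by linarith
  have z2 : g₂ = 0 := by linarith
  have hu : u₁ = c * g₁ - b * g₂ := by rw [hu₁, hg₁, hg₂, hδ]; ring
  rw [hu, z1, z2] at h1
  simp at h1

/-- A degenerate quadratic polynomial is affine along its null direction `(c, -b)`. If that
direction points into the quadrant, two parallel lines carry a common value. -/
theorem QuadInjective.not_of_nonpos {a b c d e : ℤ} (h : QuadInjective a b c d e)
    (hD : a * c = b ^ 2) (hc : 0 < c) (hb : b ≤ 0) : False := by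
  obtain ⟨l, hl⟩ : ∃ l, l = d * c - e * b := ⟨_, rfl⟩
  have line : ∀ t z, quadPoly a b c d e (t * c) (z + t * -b) = c * z ^ 2 + e * z + t * l := by
    intro t z
    simp only [quadPoly, hl]
    linear_combination t ^ 2 * c * hD
  have collide : ∀ s t z : ℤ, 0 ≤ s → 0 ≤ t → 0 ≤ z → c * z ^ 2 + e * z + s * l = t * l →
      s = t ∧ z = 0 := by
    intro s t z hs ht hz hst
    have hb' : 0 ≤ -b := by linarith
    obtain ⟨e1, e2⟩ := h (s * c) (z + s * -b) (t * c) (0 + t * -b) (by positivity)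
      (by positivity) (by positivity) (by positivity) (by rw [line, line]; linarith)
    have e3 : s = t := mul_right_cancel₀ hc.ne' e1
    subst e3
    exact ⟨rfl, by linarith⟩
  have hl0 : l ≠ 0 := by
    intro h0
    have := (collide 0 1 0 le_rfl zero_le_one le_rfl (by rw [h0]; ring)).1
    norm_num at this
  obtain ⟨σ, hσ⟩ : ∃ σ : ℤ, |l| = l * σ := by
    rcases abs_choice l with h | h
    · exact ⟨1, by rw [h]; ring⟩
    · exact ⟨-1, by rw [h]; ring⟩
  obtain ⟨m, hm⟩ : ∃ m, m = c * l * σ ^ 2 + e * σ := ⟨_, rfl⟩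
  have := (collide |m| (m + |m|) |l| (abs_nonneg _) (by linarith [neg_abs_le m]) (abs_nonneg _)
    (by rw [hσ, hm]; ring)).2
  exact hl0 (abs_eq_zero.mp this)

theorem two_mul_card_biUnion_antidiagonal_le (K : ℕ) :
    2 * ((Finset.range K).biUnion Finset.HasAntidiagonal.antidiagonal).card ≤ K * (K + 1) := by
  have h1 : ((Finset.range K).biUnion Finset.HasAntidiagonal.antidiagonal).card ≤
      ∑ i ∈ Finset.range K, (i + 1) :=
    Finset.card_biUnion_le.trans_eq
      (Finset.sum_congr rfl fun i _ => Finset.Nat.card_antidiagonal i)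
  have h2 : (∑ i ∈ Finset.range K, (i + 1)) * 2 = K * (K + 1) := by
    have := Finset.sum_range_id_mul_two (K + 1)
    rw [Finset.sum_range_succ'] at this
    simpa [mul_comm] using this
  linarith

/-- Points of a finite set in the triangle `a x + b y < a b K` are covered by `b × a` boxes. -/
theorem two_mul_card_le_of_forall_lt {a b K : ℕ} (ha : 0 < a) (hb : 0 < b) (S : Finset (ℕ × ℕ))
    (hS : ∀ p ∈ S, a * p.1 + b * p.2 < a * b * K) :
    2 * S.card ≤ a * b * (K * (K + 1)) := by
  have hle : S.card ≤ (((Finset.range K).biUnion Finset.HasAntidiagonal.antidiagonal) ×ˢ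
      (Finset.range b ×ˢ Finset.range a)).card := by
    refine Finset.card_le_card_of_injOn
      (fun p => ((p.1 / b, p.2 / a), (p.1 % b, p.2 % a))) ?_ ?_
    · intro p hp
      have hp' := hS p hp
      have hlt : p.1 / b + p.2 / a < K := by
        by_contra! hK
        have h1 := Nat.mul_le_mul_left (a * b) hK
        have h2 := Nat.mul_le_mul_left a (Nat.mul_div_le p.1 b)
        have h3 := Nat.mul_le_mul_left b (Nat.mul_div_le p.2 a)
        nlinarith
      simp [hlt, Nat.mod_lt _ ha, Nat.mod_lt _ hb]
    · intro p _ q _ hpq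
      simp only [Prod.mk.injEq] at hpq
      obtain ⟨⟨h1, h2⟩, h3, h4⟩ := hpq
      ext
      · rw [← Nat.div_add_mod p.1 b, h1, h3, Nat.div_add_mod]
      · rw [← Nat.div_add_mod p.2 a, h2, h4, Nat.div_add_mod]
  rw [Finset.card_product, Finset.card_product, Finset.card_range, Finset.card_range] at hle
  have := two_mul_card_biUnion_antidiagonal_le K
  calc 2 * S.card ≤ 2 * (((Finset.range K).biUnion
          Finset.HasAntidiagonal.antidiagonal).card * (b * a)) := Nat.mul_le_mul_left 2 hle
    _ = (2 * ((Finset.range K).biUnion Finset.HasAntidiagonal.antidiagonal).card) * (b * a) := by ring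
    _ ≤ (K * (K + 1)) * (b * a) := Nat.mul_le_mul_right _ this
    _ = a * b * (K * (K + 1)) := by ring

theorem lt_of_quadPoly_le {a b : ℕ} {c d e : ℤ} (ha : 0 < a) (hb : 2 ≤ b)
    (hD : (a : ℤ) * c = (b : ℤ) ^ 2) {K : ℕ} (hK : (K : ℤ) = |d| + |e| + 2) {x y : ℕ}
    (hxy : quadPoly a b c d e x y ≤ a * b * (K * (K + 1))) :
    a * x + b * y < a * b * K := by
  by_contra! hL
  zify at hL ha hb
  obtain ⟨L, hLdef⟩ : ∃ L : ℤ, L = a * x + b * y := ⟨_, rfl⟩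
  rw [← hLdef] at hL
  obtain ⟨κ, hκ⟩ : ∃ κ : ℤ, κ = |d| + |e| := ⟨_, rfl⟩
  have hκ0 : 0 ≤ κ := by rw [hκ]; positivity
  have hKκ : (K : ℤ) = κ + 2 := by rw [hK, hκ]
  have hx : (0 : ℤ) ≤ x := Int.natCast_nonneg x
  have hy : (0 : ℤ) ≤ y := Int.natCast_nonneg y
  have hsq : a * quadPoly a b c d e x y = L ^ 2 + a * (d * x + e * y) := by
    simp only [quadPoly, hLdef]
    linear_combination (y : ℤ) ^ 2 * hD
  have hxL : (x : ℤ) ≤ a * x := le_mul_of_one_le_left hx (by linarith)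
  have hyL : (y : ℤ) ≤ b * y := le_mul_of_one_le_left hy (by linarith)
  have hlin : -(κ * L) ≤ d * x + e * y := by
    have h1 := mul_le_mul_of_nonneg_right (neg_abs_le d) hx
    have h2 := mul_le_mul_of_nonneg_right (neg_abs_le e) hy
    have h3 : |d| * x ≤ |d| * L :=
      mul_le_mul_of_nonneg_left (by rw [hLdef]; linarith) (abs_nonneg d)
    have h4 : |e| * y ≤ |e| * L :=
      mul_le_mul_of_nonneg_left (by rw [hLdef]; linarith) (abs_nonneg e)
    rw [hκ]
    linarith
  have hab : (0 : ℤ) < a * b := by positivity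
  have hK0 : (0 : ℤ) < K := by linarith
  have hbK : (K : ℤ) + 2 ≤ b * K - κ := by nlinarith
  have hR : (a : ℤ) * (K + 2) ≤ L - a * κ := by nlinarith
  have hprod : (a * b * K : ℤ) * (a * (K + 2)) ≤ L * (L - a * κ) :=
    mul_le_mul hL hR (by positivity) (hL.trans' (by positivity))
  have h5 := mul_le_mul_of_nonneg_left hlin ha.le
  have h6 := mul_le_mul_of_nonneg_left hxy ha.le
  have h7 : (0 : ℤ) < a * (a * b * K) := by positivity
  nlinarith

theorem le_one_of_forall_exists_quadPoly_eq {a b f : ℕ} {c d e : ℤ} (ha : 0 < a)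
    (hD : (a : ℤ) * c = (b : ℤ) ^ 2)
    (hsurj : ∀ n : ℕ, ∃ p : ℕ × ℕ, quadPoly a b c d e p.1 p.2 + 2 * f = 2 * n) : b ≤ 1 := by
  by_contra! hb
  obtain ⟨K, hK⟩ : ∃ K : ℕ, (K : ℤ) = |d| + |e| + 2 :=
    ⟨(|d| + |e| + 2).toNat, Int.toNat_of_nonneg (by positivity)⟩
  choose p hp using hsurj
  have hinj : Function.Injective p := by
    intro m n hmn
    have h1 := hp m
    rw [hmn, hp n] at h1
    omega
  obtain ⟨N, hN⟩ : 2 ∣ a * b * (K * (K + 1)) :=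
    Dvd.dvd.mul_left (Nat.even_mul_succ_self K).two_dvd _
  have hcard := two_mul_card_le_of_forall_lt ha (zero_lt_one.trans hb)
    ((Finset.range (N + 1)).image p) (K := K) (by
      intro q hq
      obtain ⟨n, hn, rfl⟩ := Finset.mem_image.mp hq
      refine lt_of_quadPoly_le ha hb hD hK ?_
      have h1 := hp n
      have h2 : n ≤ N := Nat.lt_succ_iff.mp (Finset.mem_range.mp hn)
      zify at hN h2
      rw [hN]
      linarith [Int.natCast_nonneg f])
  rw [Finset.card_image_of_injective _ hinj, Finset.card_range, hN] at hcard
  omega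

theorem packing_quadratic_abc_eq_one
    (a c f : ℕ) (b d e : ℤ) (hquad : ¬ (a = 0 ∧ b = 0 ∧ c = 0))
    (had : (a : ℤ) % 2 = d % 2) (hce : (c : ℤ) % 2 = e % 2)
    (F : ℕ × ℕ → ℚ)
    (hF : ∀ p : ℕ × ℕ, F p =
      ((a : ℚ) * p.1 ^ 2 + 2 * (b : ℚ) * p.1 * p.2 + (c : ℚ) * p.2 ^ 2) / 2
        + ((d : ℚ) * p.1 + (e : ℚ) * p.2) / 2 + (f : ℚ))
    (hmaps : ∀ p : ℕ × ℕ, ∃ n : ℕ, F p = n)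
    (hbij : ∀ n : ℕ, ∃! p : ℕ × ℕ, F p = n) :
    a = 1 ∧ b = 1 ∧ c = 1 := by
  have hFG : ∀ p : ℕ × ℕ, 2 * F p = (quadPoly a b c d e p.1 p.2 + 2 * f : ℤ) := by
    intro p
    rw [hF]
    simp only [quadPoly]
    push_cast
    ring
  have hinj : QuadInjective a b c d e := by
    intro x y x' y' hx hy hx' hy' h
    lift x to ℕ using hx
    lift y to ℕ using hy
    lift x' to ℕ using hx'
    lift y' to ℕ using hy'
    obtain ⟨n, hn⟩ := hmaps (x, y)
    have h1 := hFG (x, y)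
    have h2 := hFG (x', y')
    simp only [h] at h1
    have h3 : F (x', y') = n := by rw [← hn]; linarith
    have h4 := (hbij n).unique hn h3
    simpa using h4
  have hD := hinj.mul_eq_sq
  have hbpos : 0 < b := by
    by_contra! hb
    rcases Nat.eq_zero_or_pos c with hc | hc
    · rcases Nat.eq_zero_or_pos a with ha | ha
      · subst ha
        exact hquad ⟨rfl, by simpa using hD.symm, hc⟩
      · exact hinj.swap.not_of_nonpos (by rw [mul_comm]; exact hD) (by exact_mod_cast ha) hb
    · exact hinj.not_of_nonpos hD (by exact_mod_cast hc) hb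
  have ha : 0 < a := by
    rcases Nat.eq_zero_or_pos a with ha | ha
    · subst ha
      have : b ^ 2 = 0 := by simpa using hD.symm
      exact absurd (pow_eq_zero_iff two_ne_zero |>.mp this) hbpos.ne'
    · exact ha
  lift b to ℕ using hbpos.le
  have hb1 : b ≤ 1 := by
    refine le_one_of_forall_exists_quadPoly_eq (f := f) (d := d) (e := e) ha hD fun n => ?_
    obtain ⟨p, hp, -⟩ := hbij n
    refine ⟨p, ?_⟩
    have h1 := hFG p
    rw [hp] at h1
    exact_mod_cast h1.symm
  have hb : b = 1 := by omega
  subst hb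
  have hac : a * c = 1 := by
    zify
    simpa using hD
  exact ⟨Nat.eq_one_of_mul_eq_one_right hac, rfl, Nat.eq_one_of_mul_eq_one_left hac⟩
end

section
/- (Fueter–Pólya) If F is a quadratic polynomial with real coefficients that restricts to a bijection from ℕ² to ℕ, then F(x,y) = ((x+y)² + x + 3y)/2 or F(x,y) = ((x+y)² + 3x + y)/2 for all (x,y) ∈ ℕ². -/
open Finset

/-- The residue class of a lattice point modulo `p`. -/
def residue (p : ℕ) (q : ℕ × ℕ) : ZMod p × ZMod p := (q.1, q.2)

lemma card_residue_le_of_rows {p R : ℕ} [NeZero p] {P : Finset (ℕ × ℕ)}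
    (hR : ∀ q ∈ P, q.2 < R)
    (hconv : ∀ x x' x'' y : ℕ, x ≤ x' → x' ≤ x'' → (x, y) ∈ P → (x'', y) ∈ P → (x', y) ∈ P)
    (i i' j : ZMod p) :
    #{q ∈ P | residue p q = (i, j)} ≤ #{q ∈ P | residue p q = (i', j)} + R := by
  classical
  set h := (i' - i).val with hh
  have hcast : (h : ZMod p) = i' - i := ZMod.natCast_zmod_val _
  have hlt : h < p := ZMod.val_lt _
  rw [← card_filter_add_card_filter_not (s := {q ∈ P | residue p q = (i, j)})
    (fun q => (q.1 + h, q.2) ∈ P)]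
  refine add_le_add ?_ ?_
  · refine card_le_card_of_injOn (fun q => (q.1 + h, q.2)) ?_ ?_
    · rintro ⟨x, y⟩ hq
      simp only [coe_filter, mem_filter, Set.mem_ofPred_eq, residue, Prod.mk.injEq] at hq ⊢
      refine ⟨hq.2, ?_, hq.1.2.2⟩
      push_cast
      rw [hcast, hq.1.2.1]; ring
    · rintro ⟨x, y⟩ - ⟨x', y'⟩ - hq
      simpa using hq
  · rw [← card_range R]
    refine card_le_card_of_injOn Prod.snd ?_ ?_
    · rintro q hq
      simp only [coe_filter, mem_filter, Set.mem_ofPred_eq] at hq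
      simpa using hR q hq.1.1
    · have key : ∀ x x' y : ℕ, x < x' → (x : ZMod p) = x' → (x, y) ∈ P → (x', y) ∈ P →
          (x + h, y) ∈ P := by
        intro x x' y hx he h1 h2
        refine hconv x (x + h) x' y (by omega) ?_ h1 h2
        have := (Nat.modEq_iff_dvd' hx.le).1 ((ZMod.natCast_eq_natCast_iff _ _ _).1 he)
        have := Nat.le_of_dvd (by omega) this
        omega
      rintro ⟨x, y⟩ hq ⟨x', y'⟩ hq' hy
      simp only [coe_filter, mem_filter, Set.mem_ofPred_eq, residue, Prod.mk.injEq] at hq hq' hy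
      subst hy
      rcases lt_trichotomy x x' with hx | hx | hx
      · exact absurd (key x x' y hx (hq.1.2.1.trans hq'.1.2.1.symm) hq.1.1 hq'.1.1) hq.2
      · rw [hx]
      · exact absurd (key x' x y hx (hq'.1.2.1.trans hq.1.2.1.symm) hq'.1.1 hq.1.1) hq'.2

lemma card_residue_swap (p : ℕ) (P : Finset (ℕ × ℕ)) (i j : ZMod p) :
    #{q ∈ P.map (Equiv.prodComm ℕ ℕ).toEmbedding | residue p q = (j, i)} =
      #{q ∈ P | residue p q = (i, j)} := by
  rw [filter_map, card_map]
  congr 1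
  ext q
  simp [residue, and_comm]

lemma card_residue_le {p R : ℕ} [NeZero p] {P : Finset (ℕ × ℕ)}
    (hR : ∀ q ∈ P, q.1 < R ∧ q.2 < R)
    (hrow : ∀ x x' x'' y : ℕ, x ≤ x' → x' ≤ x'' → (x, y) ∈ P → (x'', y) ∈ P → (x', y) ∈ P)
    (hcol : ∀ x y y' y'' : ℕ, y ≤ y' → y' ≤ y'' → (x, y) ∈ P → (x, y'') ∈ P → (x, y') ∈ P)
    (c c' : ZMod p × ZMod p) :
    #{q ∈ P | residue p q = c} ≤ #{q ∈ P | residue p q = c'} + 2 * R := by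
  obtain ⟨i, j⟩ := c
  obtain ⟨i', j'⟩ := c'
  have h₁ := card_residue_le_of_rows (fun q hq => (hR q hq).2) hrow i i' j
  have h₂ : #{q ∈ P | residue p q = (i', j)} ≤ #{q ∈ P | residue p q = (i', j')} + R := by
    rw [← card_residue_swap, ← card_residue_swap p P i' j']
    refine card_residue_le_of_rows ?_ ?_ j j' i'
    · rintro ⟨x, y⟩ hq
      exact (hR (y, x) (by simpa using hq)).1
    · intro x x' x'' y h h' hx hx''
      simpa using hcol y x x' x'' h h' (by simpa using hx) (by simpa using hx'')
  omega

/-- A quadratic polynomial with invertible discriminant does not take its critical value exactly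
`#K` times over a finite field `K` of odd characteristic. -/
lemma exists_card_fiber_ne_card {K : Type*} [Field K] [Fintype K] [DecidableEq K]
    (A B C D E f : K) (h2 : (2 : K) ≠ 0) (hA : A ≠ 0) (hδ : B ^ 2 - A * C ≠ 0) :
    ∃ r : K, #{c : K × K |
      A * c.1 ^ 2 + 2 * B * c.1 * c.2 + C * c.2 ^ 2 + D * c.1 + E * c.2 + f = 2 * r}
        ≠ Fintype.card K := by
  set δ := B ^ 2 - A * C with hδdef
  obtain ⟨x₀, hx₀⟩ : ∃ x₀, 2 * δ * x₀ = C * D - B * E := ⟨(C * D - B * E) / (2 * δ), by field_simp⟩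
  obtain ⟨y₀, hy₀⟩ : ∃ y₀, 2 * δ * y₀ = A * E - B * D := ⟨(A * E - B * D) / (2 * δ), by field_simp⟩
  have g₁ : 2 * A * x₀ + 2 * B * y₀ + D = 0 := by
    apply mul_left_cancel₀ hδ
    linear_combination A * hx₀ + B * hy₀ + D * hδdef
  have g₂ : 2 * B * x₀ + 2 * C * y₀ + E = 0 := by
    apply mul_left_cancel₀ hδ
    linear_combination B * hx₀ + C * hy₀ + E * hδdef
  obtain ⟨r, hr⟩ : ∃ r, 2 * r = A * x₀ ^ 2 + 2 * B * x₀ * y₀ + C * y₀ ^ 2 + D * x₀ + E * y₀ + f :=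
    ⟨(A * x₀ ^ 2 + 2 * B * x₀ * y₀ + C * y₀ ^ 2 + D * x₀ + E * y₀ + f) / 2, by field_simp⟩
  have key : ∀ x y : K, A * x ^ 2 + 2 * B * x * y + C * y ^ 2 + D * x + E * y + f = 2 * r ↔
      (A * (x - x₀) + B * (y - y₀)) ^ 2 = δ * (y - y₀) ^ 2 := by
    intro x y
    constructor
    · intro h
      linear_combination A * h + A * hr - A * (x - x₀) * g₁ - A * (y - y₀) * g₂ - (y - y₀) ^ 2 * hδdef
    · intro h
      apply mul_left_cancel₀ hA
      linear_combination h - A * hr + A * (x - x₀) * g₁ + A * (y - y₀) * g₂ + (y - y₀) ^ 2 * hδdef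
  refine ⟨r, ?_⟩
  simp only [key]
  by_cases hs : IsSquare δ
  · refine ne_of_gt ?_
    obtain ⟨s, hs⟩ := hs
    have hs0 : s ≠ 0 := by rintro rfl; simp at hs; exact hδ hs
    let φ : Option K → K × K := fun o => o.elim (x₀ + (-s - B) / A, y₀ + 1)
      (fun v => (x₀ + (s - B) / A * v, y₀ + v))
    have hφ : Function.Injective φ := by
      have aux : ∀ v, φ none ≠ φ (some v) := by
        intro v hv
        simp only [φ, Option.elim, Prod.mk.injEq, add_right_inj] at hv
        obtain ⟨h1, rfl⟩ := hv
        field_simp at h1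
        exact mul_ne_zero h2 hs0 (by linear_combination -h1)
      rintro (_ | v) (_ | w) h
      · rfl
      · exact absurd h (aux w)
      · exact absurd h.symm (aux v)
      · simp only [φ, Option.elim, Prod.mk.injEq, add_right_inj] at h
        rw [h.2]
    have hcard : Fintype.card K < Fintype.card (Option K) := by simp
    refine hcard.trans_le ?_
    rw [← card_univ]
    refine card_le_card_of_injOn φ ?_ hφ.injOn
    rintro (_ | v) -
    · simp only [φ, Option.elim, coe_filter, mem_univ, true_and, Set.mem_ofPred_eq, hs]
      field_simp
      ring
    · simp only [φ, Option.elim, coe_filter, mem_univ, true_and, Set.mem_ofPred_eq, hs]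
      field_simp
      ring
  · refine ne_of_eq_of_ne (b := 1) ?_ Fintype.one_lt_card.ne
    rw [card_eq_one]
    refine ⟨(x₀, y₀), ?_⟩
    ext ⟨x, y⟩
    simp only [mem_filter, mem_univ, true_and, mem_singleton, Prod.mk.injEq]
    constructor
    · intro h
      have hy : y - y₀ = 0 := by
        by_contra hy
        exact hs ⟨(A * (x - x₀) + B * (y - y₀)) / (y - y₀), by field_simp; linear_combination -h⟩
      have hx : x - x₀ = 0 := by
        rw [hy] at h
        simpa [hA] using h
      exact ⟨sub_eq_zero.1 hx, sub_eq_zero.1 hy⟩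
    · rintro ⟨rfl, rfl⟩
      simp

lemma card_range_mul_filter_natCast (p m : ℕ) [NeZero p] (r : ZMod p) :
    #{n ∈ range (p * m) | ((n : ℕ) : ZMod p) = r} = m := by
  have h := Nat.count_modEq_card (p * m) (NeZero.pos p) r.val
  rw [Nat.count_eq_card_filter_range] at h
  have e : ∀ n : ℕ, (n : ZMod p) = r ↔ n ≡ r.val [MOD p] := by
    intro n
    rw [← ZMod.natCast_eq_natCast_iff, ZMod.natCast_zmod_val]
  simp only [e]
  rw [h]
  simp [NeZero.pos p]

lemma card_mul_le_of_linear_lt {A B T : ℕ} (P : Finset (ℕ × ℕ))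
    (hP : ∀ q ∈ P, A * q.1 + B * q.2 < T) :
    2 * (#P * (A * B)) ≤ (T + A + B) * (T + A + B + 1) := by
  have hle : #(P ×ˢ (range A ×ˢ range B)) ≤ #((range (T + A + B)).sigma antidiagonal) := by
    refine card_le_card_of_injOn
      (fun z => ⟨A * z.1.1 + z.2.1 + (B * z.1.2 + z.2.2), A * z.1.1 + z.2.1, B * z.1.2 + z.2.2⟩)
      ?_ ?_
    · rintro ⟨⟨x, y⟩, i, j⟩ hz
      simp only [coe_product, Set.mem_prod, mem_coe, mem_range] at hz
      have := hP _ hz.1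
      simp only [mem_coe, mem_sigma, mem_range, HasAntidiagonal.mem_antidiagonal, and_true] at this ⊢
      omega
    · rintro ⟨⟨x, y⟩, i, j⟩ hz ⟨⟨x', y'⟩, i', j'⟩ hz' heq
      simp only [coe_product, Set.mem_prod, mem_coe, mem_range] at hz hz'
      have heq' : A * x + i = A * x' + i' ∧ B * y + j = B * y' + j' := by
        have := (Sigma.mk.inj_iff.1 heq)
        simpa using eq_of_heq this.2
      have div : ∀ {a q b c d : ℕ}, b < a → d < a → a * q + b = a * c + d → q = c ∧ b = d := by
        intro a q b c d hb hd h
        have h₁ := congrArg (· / a) h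
        have ha : 0 < a := by omega
        simp only [Nat.mul_add_div ha, Nat.div_eq_of_lt hb, Nat.div_eq_of_lt hd, add_zero] at h₁
        subst h₁
        omega
      obtain ⟨rfl, rfl⟩ := div hz.2.1 hz'.2.1 heq'.1
      obtain ⟨rfl, rfl⟩ := div hz.2.2 hz'.2.2 heq'.2
      rfl
  simp only [card_product, card_range, card_sigma, Nat.card_antidiagonal] at hle
  have hsum := sum_range_id_mul_two (T + A + B + 1)
  rw [sum_range_succ'] at hsum
  simp only [add_zero, Nat.add_sub_cancel] at hsum
  linarith

/-- `e` is a pairing function whose double is given by an integral quadratic polynomial. -/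
def IsQuadraticPacking (A B C D E f : ℤ) (e : ℕ × ℕ ≃ ℕ) : Prop :=
  ∀ x y : ℕ, 2 * (e (x, y) : ℤ) = A * x ^ 2 + 2 * B * x * y + C * y ^ 2 + D * x + E * y + f

lemma nonneg_of_forall_quadratic_nonneg {α β γ : ℤ}
    (h : ∀ t : ℕ, 0 ≤ α * t ^ 2 + β * t + γ) : 0 ≤ α := by
  by_contra! hα
  have := h (β.natAbs + γ.natAbs + 1)
  push_cast at this
  have h1 := le_abs_self β
  have h2 := le_abs_self γ
  have h3 := abs_nonneg β
  have h4 := abs_nonneg γ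
  set t := |β| + |γ| + 1
  nlinarith [mul_nonneg h3 h4]

lemma nonneg_of_forall_linear_nonneg {β γ : ℤ} (h : ∀ t : ℕ, 0 ≤ β * t + γ) : 0 ≤ β := by
  by_contra! hβ
  have := h (γ.natAbs + 1)
  push_cast at this
  have h2 := le_abs_self γ
  nlinarith [abs_nonneg γ]

namespace IsQuadraticPacking

variable {A B C D E f : ℤ} {e : ℕ × ℕ ≃ ℕ}

lemma swap (h : IsQuadraticPacking A B C D E f e) :
    IsQuadraticPacking C B A E D f ((Equiv.prodComm ℕ ℕ).trans e) := by
  intro x y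
  have := h y x
  simp only [Equiv.trans_apply, Equiv.prodComm_apply, Prod.swap_prod_mk]
  linarith

lemma nonneg (h : IsQuadraticPacking A B C D E f e) (x y : ℕ) :
    0 ≤ A * x ^ 2 + 2 * B * x * y + C * y ^ 2 + D * x + E * y + f := by
  rw [← h x y]
  positivity

lemma eq_of_eval_eq (h : IsQuadraticPacking A B C D E f e) {x y x' y' : ℕ}
    (heq : A * x ^ 2 + 2 * B * x * y + C * y ^ 2 + D * x + E * y + f =
      A * x' ^ 2 + 2 * B * x' * y' + C * y' ^ 2 + D * x' + E * y' + f) : x = x' ∧ y = y' := by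
  rw [← h x y, ← h x' y'] at heq
  have : e (x, y) = e (x', y') := by omega
  simpa using e.injective this

lemma leading_coeff_pos (h : IsQuadraticPacking A B C D E f e) : 0 < A := by
  have hA : 0 ≤ A := nonneg_of_forall_quadratic_nonneg (β := D) (γ := f) fun t => by
    simpa using h.nonneg t 0
  refine lt_of_le_of_ne hA fun hA0 => ?_
  subst hA0
  have hlin : ∀ y : ℕ, 0 ≤ 2 * B * y + D := fun y =>
    nonneg_of_forall_linear_nonneg (γ := C * y ^ 2 + E * y + f) fun t => by
      have := h.nonneg t y
      linarith
  have hB : 0 ≤ 2 * B := nonneg_of_forall_linear_nonneg hlin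
  have hD : 0 ≤ D := by simpa using hlin 0
  have hD0 : D ≠ 0 := by
    rintro rfl
    have := h.eq_of_eval_eq (x := 0) (y := 0) (x' := 1) (y' := 0) (by simp)
    simp at this
  lift D to ℕ using hD
  obtain ⟨k, hk⟩ : ∃ k : ℕ, (k : ℤ) = (C * D + E).natAbs * (2 * B + 1) + C * D + E := by
    refine ⟨((C * D + E).natAbs * (2 * B + 1) + C * D + E).toNat, Int.toNat_of_nonneg ?_⟩
    have := neg_abs_le (C * D + E)
    push_cast
    nlinarith [abs_nonneg (C * D + E)]
  have := h.eq_of_eval_eq (x := k) (y := 0) (x' := (C * D + E).natAbs) (y' := D)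
    (by rw [hk]; push_cast; ring)
  exact hD0 (by exact_mod_cast this.2.symm)

lemma mixed_coeff_nonneg (h : IsQuadraticPacking A B C D E f e) (hδ : 0 ≤ B ^ 2 - A * C) :
    0 ≤ B := by
  by_contra! hB
  have hA := h.leading_coeff_pos
  obtain ⟨m, rfl⟩ : ∃ m : ℕ, A = m := ⟨A.toNat, by omega⟩
  obtain ⟨n, rfl⟩ : ∃ n : ℕ, B = -n := ⟨(-B).toNat, by omega⟩
  have hδ' : (-(n : ℤ)) ^ 2 - m * C = 0 := by
    have : 0 ≤ -(m * ((-(n : ℤ)) ^ 2 - m * C)) :=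
      nonneg_of_forall_quadratic_nonneg (β := D * n + E * m) (γ := f) fun t => by
        have := h.nonneg (n * t) (m * t)
        push_cast at this
        linarith
    nlinarith
  have shift : ∀ x y t : ℕ,
      2 * (e (x + n * t, y + m * t) : ℤ) = 2 * e (x, y) + (D * n + E * m) * t := by
    intro x y t
    rw [h, h]
    push_cast
    linear_combination (-2 * y * t - m * t ^ 2 : ℤ) * hδ'
  have hκ : 0 ≤ D * n + E * m :=
    nonneg_of_forall_linear_nonneg (γ := 2 * e (0, 0)) fun t => by
      have := shift 0 0 t
      omega
  obtain ⟨κ, hκ'⟩ : ∃ κ : ℕ, D * n + E * m = 2 * κ := by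
    have := shift 0 0 1
    exact ⟨((D * n + E * m) / 2).toNat, by omega⟩
  have hκ0 : κ ≠ 0 := by
    rintro rfl
    have := shift 0 0 1
    rw [hκ'] at this
    have : e (0 + n * 1, 0 + m * 1) = e (0, 0) := by
      push_cast at this; omega
    have := e.injective this
    simp at this
    omega
  have collide : ∀ x x' : ℕ, e (x, 0) ≤ e (x', 0) → (e (x, 0) : ZMod κ) = e (x', 0) →
      x = x' := by
    intro x x' hle hmod
    obtain ⟨t, ht⟩ := (Nat.modEq_iff_dvd' hle).1 ((ZMod.natCast_eq_natCast_iff _ _ _).1 hmod)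
    have hs := shift x 0 t
    rw [hκ'] at hs
    have : (e (x', 0) : ℤ) = e (x, 0) + κ * t := by
      have : e (x', 0) = e (x, 0) + κ * t := by omega
      exact_mod_cast this
    have : e (x + n * t, 0 + m * t) = e (x', 0) := by
      have : (e (x + n * t, 0 + m * t) : ℤ) = e (x', 0) := by linarith
      exact_mod_cast this
    have := e.injective this
    simp only [Prod.mk.injEq, zero_add, mul_eq_zero] at this
    obtain ⟨h1, h2 | h2⟩ := this
    · omega
    · simpa [h2] using h1
  have : NeZero κ := ⟨hκ0⟩
  obtain ⟨x, x', hne, heq⟩ :=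
    Finite.exists_ne_map_eq_of_infinite (fun x : ℕ => (e (x, 0) : ZMod κ))
  rcases le_total (e (x, 0)) (e (x', 0)) with hle | hle
  · exact hne (collide x x' hle heq)
  · exact hne (collide x' x hle heq.symm).symm

lemma exists_sq_le (h : IsQuadraticPacking A B C D E f e) :
    ∃ K : ℕ, ∀ x y : ℕ, y ^ 2 ≤ K * (e (x, y) + 1) := by
  have hA := h.leading_coeff_pos
  have hC := h.swap.leading_coeff_pos
  suffices ∃ K : ℤ, 0 ≤ K ∧ ∀ x y : ℕ, (y : ℤ) ^ 2 ≤ K * (e (x, y) + 1) by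
    obtain ⟨K, hK, hle⟩ := this
    lift K to ℕ using hK
    exact ⟨K, fun x y => by exact_mod_cast hle x y⟩
  rcases lt_or_ge (B ^ 2 - A * C) 0 with hneg | hpos
  · set M := (A * E - B * D) ^ 2 * 4 + D ^ 2 + 4 * A * |f| with hM
    refine ⟨8 * A + M, by positivity, fun x y => ?_⟩
    have h0 := h x y
    have hid : 4 * A * (2 * (e (x, y) : ℤ)) = (2 * A * x + 2 * B * y + D) ^ 2
        - 4 * (B ^ 2 - A * C) * y ^ 2 + 4 * (A * E - B * D) * y + 4 * A * f - D ^ 2 := by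
      rw [h0]; ring
    have h1 : (y : ℤ) ^ 2 ≤ -(B ^ 2 - A * C) * y ^ 2 := by nlinarith [sq_nonneg (y : ℤ)]
    have h2 := mul_le_mul_of_nonneg_left (neg_abs_le f) (by positivity : 0 ≤ 4 * A)
    have h3 : 0 ≤ M := by positivity
    nlinarith [sq_nonneg (2 * A * x + 2 * B * y + D), sq_nonneg ((y : ℤ) + 2 * (A * E - B * D)),
      mul_nonneg h3 (Nat.cast_nonneg (α := ℤ) (e (x, y))), sq_nonneg (y : ℤ)]
  · have hB := h.mixed_coeff_nonneg hpos
    set M := D ^ 2 + E ^ 2 + 2 * |f| with hM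
    refine ⟨4 + M, by positivity, fun x y => ?_⟩
    have h0 := h x y
    have h1 : 0 ≤ B * x * y := by positivity
    have h2 : (x : ℤ) ^ 2 ≤ A * x ^ 2 := by nlinarith [sq_nonneg (x : ℤ)]
    have h3 : (y : ℤ) ^ 2 ≤ C * y ^ 2 := by nlinarith [sq_nonneg (y : ℤ)]
    have h4 : 0 ≤ M := by positivity
    nlinarith [sq_nonneg (2 * x + D), sq_nonneg ((y : ℤ) + E), neg_abs_le f,
      mul_nonneg h4 (Nat.cast_nonneg (α := ℤ) (e (x, y))), sq_nonneg (x + D)]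

lemma row_convex (h : IsQuadraticPacking A B C D E f e) {n x x' x'' y : ℕ} (hx : x ≤ x')
    (hx' : x' ≤ x'') (h₁ : e (x, y) < n) (h₂ : e (x'', y) < n) : e (x', y) < n := by
  have hA := h.leading_coeff_pos
  rcases hx.eq_or_lt with rfl | hlt
  · exact h₁
  obtain ⟨a, rfl⟩ := Nat.exists_eq_add_of_le hx
  obtain ⟨b, rfl⟩ := Nat.exists_eq_add_of_le hx'
  have ha : 0 < a := by omega
  have e₁ := h x y
  have e₂ := h (x + a) y
  have e₃ := h (x + a + b) y
  push_cast at e₁ e₂ e₃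
  have key : (a + b : ℤ) * (2 * e (x + a, y)) =
      b * (2 * e (x, y)) + a * (2 * e (x + a + b, y)) - A * a * b * (a + b) := by
    rw [e₁, e₂, e₃]; ring
  have : (0 : ℤ) ≤ A * a * b * (a + b) := by positivity
  zify at h₁ h₂ ha ⊢
  by_contra! hcon
  nlinarith

lemma coeff_eq_one (h : IsQuadraticPacking 1 1 1 D E f e) (hlt : E < D) :
    D = 3 ∧ E = 1 ∧ f = 0 := by
  have h00 := h 0 0
  have h01 := h 0 1
  have h10 := h 1 0
  push_cast at h00 h01 h10
  obtain ⟨ε, rfl⟩ : ∃ ε, E = 2 * ε - 1 := ⟨(E + 1) / 2, by omega⟩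
  obtain ⟨κ, rfl⟩ : ∃ κ, D = 2 * ε - 1 + 2 * κ := ⟨(D - (2 * ε - 1)) / 2, by omega⟩
  have collide : ∀ x y : ℕ, (x : ℤ) + y + ε = κ * x → False := by
    intro x y hxy
    have := h.eq_of_eval_eq (x := x) (y := y) (x' := 0) (y' := x + y + 1)
      (by push_cast; linear_combination -2 * hxy)
    omega
  have hκ : κ = 1 := by
    by_contra hne
    have hκ2 : 2 ≤ κ := by omega
    have h1 := le_abs_self ε
    refine collide ε.natAbs ((κ - 1) * |ε| - ε).toNat ?_
    rw [Int.toNat_of_nonneg (by nlinarith [abs_nonneg ε])]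
    push_cast
    ring
  subst hκ
  have hε : 1 ≤ ε := by
    by_contra! hle
    exact collide 0 (-ε).toNat (by rw [Int.toNat_of_nonneg (by omega)]; push_cast; ring)
  have hf : f = 0 := by
    obtain ⟨⟨x, y⟩, hxy⟩ := e.surjective 0
    have := h x y
    rw [hxy] at this
    push_cast at this
    nlinarith [mul_nonneg (by omega : 0 ≤ 2 * ε - 1) (Nat.cast_nonneg (α := ℤ) y),
      mul_nonneg (by omega : 0 ≤ 2 * ε - 1 + 2 * 1) (Nat.cast_nonneg (α := ℤ) x)]
  subst hf
  obtain ⟨⟨x, y⟩, hxy⟩ := e.surjective 1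
  have h1 := h x y
  rw [hxy] at h1
  push_cast at h1
  have hy0 : (0 : ℤ) ≤ y := by positivity
  have hx0 : x = 0 := by
    by_contra hx
    have : (1 : ℤ) ≤ x := by exact_mod_cast Nat.one_le_iff_ne_zero.2 hx
    nlinarith [mul_nonneg (by omega : 0 ≤ 2 * ε - 1) hy0,
      mul_le_mul_of_nonneg_left this (by omega : 0 ≤ 2 * ε - 1)]
  subst hx0
  have hy : 1 ≤ (y : ℤ) := by
    by_contra! hlt
    have : (y : ℤ) = 0 := by omega
    rw [this] at h1
    simp at h1
  have : 2 * ε - 1 ≤ 1 := by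
    push_cast at h1
    nlinarith
  omega

lemma col_convex (h : IsQuadraticPacking A B C D E f e) {n x y y' y'' : ℕ} (hy : y ≤ y')
    (hy' : y' ≤ y'') (h₁ : e (x, y) < n) (h₂ : e (x, y'') < n) : e (x, y') < n :=
  h.swap.row_convex hy hy' h₁ h₂

lemma discr_eq_zero (h : IsQuadraticPacking A B C D E f e) : B ^ 2 - A * C = 0 := by
  classical
  by_contra hδ
  have hA := h.leading_coeff_pos
  obtain ⟨K, hK, hbd⟩ : ∃ K : ℕ, 0 < K ∧
      ∀ x y : ℕ, x ^ 2 ≤ K * (e (x, y) + 1) ∧ y ^ 2 ≤ K * (e (x, y) + 1) := by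
    obtain ⟨K₁, h₁⟩ := h.exists_sq_le
    obtain ⟨K₂, h₂⟩ := h.swap.exists_sq_le
    refine ⟨K₁ + K₂ + 1, by omega, fun x y => ⟨(h₂ y x).trans ?_, (h₁ x y).trans ?_⟩⟩
    · exact Nat.mul_le_mul_right _ (by omega)
    · exact Nat.mul_le_mul_right _ (by omega)
  obtain ⟨p, hpl, hp⟩ := Nat.exists_infinite_primes ((2 * A * (B ^ 2 - A * C)).natAbs + 1)
  have : Fact p.Prime := ⟨hp⟩
  have hne : ((2 * A * (B ^ 2 - A * C) : ℤ) : ZMod p) ≠ 0 := by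
    rw [Ne, ZMod.intCast_zmod_eq_zero_iff_dvd]
    intro hdvd
    have h0 : 2 * A * (B ^ 2 - A * C) ≠ 0 := by positivity
    have := Nat.le_of_dvd (Int.natAbs_pos.2 h0) (Int.natCast_dvd.1 hdvd)
    omega
  push_cast at hne
  have h2 : (2 : ZMod p) ≠ 0 := left_ne_zero_of_mul (left_ne_zero_of_mul hne)
  obtain ⟨r, hr⟩ := exists_card_fiber_ne_card (A : ZMod p) B C D E f h2
    (right_ne_zero_of_mul (left_ne_zero_of_mul hne)) (right_ne_zero_of_mul hne)
  rw [ZMod.card] at hr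
  set Z : Finset (ZMod p × ZMod p) := {c | (A : ZMod p) * c.1 ^ 2 + 2 * B * c.1 * c.2 +
    C * c.2 ^ 2 + D * c.1 + E * c.2 + f = 2 * r} with hZ
  set t := 2 * p ^ 3 + 2 with ht
  set m := K * p * t ^ 2 with hm
  set R := K * p * t + 1 with hRdef
  set P := (range (p * m)).map e.symm.toEmbedding with hP
  have hmem : ∀ q, q ∈ P ↔ e q < p * m := by
    intro q
    rw [hP, mem_map_equiv, mem_range, Equiv.symm_symm]
  have hbound : ∀ q ∈ P, q.1 < R ∧ q.2 < R := by
    rintro ⟨x, y⟩ hq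
    have hle : K * (e (x, y) + 1) ≤ (K * p * t) ^ 2 := by
      calc K * (e (x, y) + 1) ≤ K * (p * m) := Nat.mul_le_mul_left _ ((hmem _).1 hq)
        _ = (K * p * t) ^ 2 := by rw [hm]; ring
    exact ⟨Nat.lt_succ_of_le ((Nat.pow_le_pow_iff_left two_ne_zero).1 ((hbd x y).1.trans hle)),
      Nat.lt_succ_of_le ((Nat.pow_le_pow_iff_left two_ne_zero).1 ((hbd x y).2.trans hle))⟩
  have hcompare := card_residue_le (p := p) hbound
    (fun x x' x'' y hx hx' h₁ h₂ =>
      (hmem _).2 (h.row_convex hx hx' ((hmem _).1 h₁) ((hmem _).1 h₂)))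
    (fun x y y' y'' hy hy' h₁ h₂ =>
      (hmem _).2 (h.col_convex hy hy' ((hmem _).1 h₁) ((hmem _).1 h₂)))
  set N : ZMod p × ZMod p → ℕ := fun c => #{q ∈ P | residue p q = c} with hN
  have htotal : ∑ c, N c = p * m := by
    rw [← card_eq_sum_card_fiberwise (fun q _ => mem_univ _), hP, card_map, card_range]
  have hfiber : ∀ q, residue p q ∈ Z ↔ (e q : ZMod p) = r := by
    rintro ⟨x, y⟩
    have := congrArg (Int.cast (R := ZMod p)) (h x y)
    push_cast at this
    rw [hZ, mem_filter, residue, ← this]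
    simp [h2]
  have hsum : ∑ c ∈ Z, N c = m := by
    have h₁ : #{q ∈ P | residue p q ∈ Z} = ∑ c ∈ Z, #{q ∈ {q ∈ P | residue p q ∈ Z} |
        residue p q = c} := card_eq_sum_card_fiberwise fun q hq => (mem_filter.1 hq).2
    have h₂ : #{q ∈ P | residue p q ∈ Z} = m := by
      rw [hP, filter_map, card_map]
      refine Eq.trans ?_ (card_range_mul_filter_natCast p m r)
      congr 1
      ext n
      simp [hfiber]
    refine Eq.trans ?_ (h₁.symm.trans h₂)
    refine sum_congr rfl fun c hc => ?_
    simp only [hN, filter_filter]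
    congr 1
    ext q
    simp only [mem_filter]
    constructor
    · rintro ⟨h1, rfl⟩; exact ⟨h1, hc, rfl⟩
    · rintro ⟨h1, -, h3⟩; exact ⟨h1, h3⟩
  have hcard : #(univ : Finset (ZMod p × ZMod p)) = p * p := by
    rw [card_univ, Fintype.card_prod, ZMod.card]
  have hup : #Z * (p * m) ≤ p * p * (m + #Z * (2 * R)) := by
    rw [← htotal, mul_sum, ← hcard, ← smul_eq_mul #univ]
    refine sum_le_card_nsmul _ _ _ fun c _ => ?_
    rw [← hsum, ← smul_eq_mul #Z, ← smul_eq_mul #Z, ← sum_const, ← sum_const, ← sum_add_distrib]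
    exact sum_le_sum fun c' _ => hcompare c c'
  have hlow : p * p * m ≤ #Z * (p * m + p * p * (2 * R)) := by
    rw [← htotal, ← hsum, mul_sum, ← smul_eq_mul #Z]
    refine sum_le_card_nsmul _ _ _ fun c _ => ?_
    rw [← hcard, ← smul_eq_mul #univ, ← smul_eq_mul #univ, ← sum_const, ← sum_const,
      ← sum_add_distrib]
    exact sum_le_sum fun c' _ => hcompare c c'
  have hp0 := hp.pos
  have hup' : #Z * m ≤ p * (m + #Z * (2 * R)) :=
    Nat.le_of_mul_le_mul_left (by linarith) hp0
  have hlow' : p * m ≤ #Z * (m + p * (2 * R)) :=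
    Nat.le_of_mul_le_mul_left (by linarith) hp0
  have hZle : #Z ≤ p * p := hcard ▸ card_le_univ Z
  have hmR : m ≤ 2 * R * p ^ 3 := by
    have hle : p * (#Z * (2 * R)) ≤ 2 * R * p ^ 3 := by
      calc p * (#Z * (2 * R)) ≤ p * (p * p * (2 * R)) := by gcongr
        _ = 2 * R * p ^ 3 := by ring
    rcases lt_or_gt_of_ne hr with hlt | hgt
    · nlinarith [Nat.mul_le_mul_right m hlt]
    · nlinarith [Nat.mul_le_mul_right m hgt]
  have hKp : 1 ≤ K * p := Nat.mul_pos hK hp0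
  have hKt : t ≤ K * p * t := Nat.le_mul_of_pos_left t hKp
  have : m = K * p * t * (2 * p ^ 3 + 2) := by rw [hm, ht]; ring
  rw [this, hRdef] at hmR
  nlinarith

lemma mixed_coeff_le_one (h : IsQuadraticPacking A B C D E f e) : B ≤ 1 := by
  by_contra! hB
  have hδ := h.discr_eq_zero
  have hA := h.leading_coeff_pos
  have hle : ∃ K : ℤ, 0 ≤ K ∧ ∀ x y : ℕ,
      (A * x + B * y) ^ 2 - K * (A * x + B * y) - K ≤ 2 * A * e (x, y) := by
    refine ⟨A * |D| + A * |E| + A * |f|, by positivity, fun x y => ?_⟩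
    have h0 : 2 * A * (e (x, y) : ℤ) =
        (A * x + B * y) ^ 2 + A * D * x + A * E * y + A * f := by
      linear_combination A * h x y - y ^ 2 * hδ
    have b1 : -(|D| * (A * x)) ≤ A * D * x := by
      have := mul_le_mul_of_nonneg_right (neg_abs_le D) (by positivity : 0 ≤ A * (x : ℤ))
      linarith
    have b2 : -(|E| * A * (B * y)) ≤ A * E * y := by
      have h1 := mul_le_mul_of_nonneg_right (neg_abs_le E) (by positivity : 0 ≤ A * (y : ℤ))
      have h2 : 0 ≤ |E| * A * y := by positivity
      nlinarith
    have b3 : -(|f| * A) ≤ A * f := by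
      have := mul_le_mul_of_nonneg_right (neg_abs_le f) hA.le
      linarith
    have b4 : 0 ≤ |D| * (A - 1) * (A * x) := by
      have : 0 ≤ A - 1 := by omega
      positivity
    have b5 : 0 ≤ A * |D| * (B * y) + A * |E| * (A * x) + A * |f| * (A * x + B * y) +
      A * |D| + A * |E| := by positivity
    nlinarith
  obtain ⟨K, hK, hle⟩ := hle
  lift K to ℕ using hK
  lift A to ℕ using hA.le
  lift B to ℕ using by omega
  obtain ⟨w, hw⟩ : ∃ w : ℕ, w = K + B + 10 := ⟨_, rfl⟩
  obtain ⟨n, hn⟩ : ∃ n : ℕ, (n : ℤ) = 2 * A * w ^ 2 - K * w - K := by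
    refine ⟨(2 * A * w ^ 2 - K * w - K : ℤ).toNat, Int.toNat_of_nonneg ?_⟩
    have : (w : ℤ) ^ 2 ≤ A * w ^ 2 := le_mul_of_one_le_left (by positivity) (by omega)
    have : (K : ℤ) * w ≤ w * w := mul_le_mul_of_nonneg_right (by omega) (by positivity)
    have : (K : ℤ) * 1 ≤ w * w := mul_le_mul (by omega) (by omega) (by omega) (by omega)
    linarith
  have hP := card_mul_le_of_linear_lt (A := A) (B := B) (T := 2 * A * w)
    ((range n).map e.symm.toEmbedding) ?_
  · rw [card_map, card_range] at hP
    zify at hP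
    rw [hn] at hP
    replace hw : (w : ℤ) = K + B + 10 := by exact_mod_cast hw
    have hK : (0 : ℤ) ≤ K := by positivity
    generalize (A : ℤ) = A, (B : ℤ) = B, (K : ℤ) = K, (w : ℤ) = w at *
    have hw0 : 0 ≤ w := by omega
    have a1 : A ≤ A ^ 2 := by nlinarith
    have a2 : A ^ 2 ≤ A ^ 2 * (B - 1) := by nlinarith
    have a3 : A * B ≤ A ^ 2 * B := by nlinarith
    have b1 : A ^ 2 * B * w ^ 2 ≤ 2 * (A ^ 2 * (B - 1) * w ^ 2) := by
      nlinarith [mul_nonneg (mul_nonneg (sq_nonneg A) (by omega : 0 ≤ B - 2)) (sq_nonneg w)]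
    have b2 : 2 * A * w * (2 * A + 2 * B + 1) ≤ 10 * (A ^ 2 * B) * w := by
      nlinarith
    have b3 : (A + B) * (A + B + 1) ≤ A ^ 2 * B * (5 + B) := by
      nlinarith
    have b4 : A * B * (2 * K * (w + 1)) ≤ A ^ 2 * B * (2 * K * (w + 1)) :=
      mul_le_mul_of_nonneg_right a3 (by positivity)
    have b5 : 0 < A ^ 2 * B * (2 * w ^ 2 - 2 * K * (w + 1) - 10 * w - (5 + B)) := by
      refine mul_pos (by positivity) ?_
      subst hw
      nlinarith
    nlinarith
  · rintro ⟨x, y⟩ hq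
    rw [mem_map_equiv, mem_range, Equiv.symm_symm] at hq
    have h1 := hle x y
    by_contra! hcon
    zify at hq hcon
    have h2 : (w : ℤ) ≤ A * w := le_mul_of_one_le_left (by positivity) (by omega)
    have h3 : 0 ≤ (A * x + B * y - 2 * A * w : ℤ) * (A * x + B * y + 2 * A * w - K) :=
      mul_nonneg (by omega) (by linarith)
    have h4 : (2 * A * e (x, y) : ℤ) < 2 * A * n := mul_lt_mul_of_pos_left hq (by positivity)
    have h5 : (K : ℤ) ≤ A * K := le_mul_of_one_le_left (by positivity) (by omega)
    have h6 : (2 * A * n : ℤ) = (2 * A * w) ^ 2 - K * (2 * A * w) - 2 * A * K := by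
      rw [hn]; ring
    nlinarith

lemma coeff_eq (h : IsQuadraticPacking A B C D E f e) :
    A = 1 ∧ B = 1 ∧ C = 1 ∧ f = 0 ∧ (D = 1 ∧ E = 3 ∨ D = 3 ∧ E = 1) := by
  have hA := h.leading_coeff_pos
  have hC := h.swap.leading_coeff_pos
  have hδ := h.discr_eq_zero
  have hB := h.mixed_coeff_nonneg hδ.ge
  have hB' := h.mixed_coeff_le_one
  have hAC : 0 < A * C := mul_pos hA hC
  obtain rfl : B = 1 := by
    by_contra hne
    obtain rfl : B = 0 := by omega
    omega
  have hAC1 : A * C = 1 := by omega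
  obtain rfl : A = 1 := Int.eq_one_of_mul_eq_one_right hA.le hAC1
  obtain rfl : C = 1 := by omega
  rcases lt_trichotomy E D with hlt | rfl | hlt
  · obtain ⟨rfl, rfl, rfl⟩ := h.coeff_eq_one hlt
    simp
  · have := h.eq_of_eval_eq (x := 0) (y := 1) (x' := 1) (y' := 0) (by simp)
    simp at this
  · obtain ⟨rfl, rfl, rfl⟩ := h.swap.coeff_eq_one hlt
    simp

end IsQuadraticPacking

theorem fueter_polya
    (a b c d e f : ℝ) (hquad : ¬ (a = 0 ∧ b = 0 ∧ c = 0))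
    (F : ℝ → ℝ → ℝ)
    (hF : ∀ x y : ℝ, F x y = a * x ^ 2 + b * x * y + c * y ^ 2 + d * x + e * y + f)
    (hmaps : ∀ x y : ℕ, ∃ n : ℕ, F x y = n)
    (hbij : ∀ n : ℕ, ∃! p : ℕ × ℕ, F p.1 p.2 = n) :
    (∀ x y : ℕ, F x y = (((x : ℝ) + y) ^ 2 + x + 3 * y) / 2) ∨
    (∀ x y : ℕ, F x y = (((x : ℝ) + y) ^ 2 + 3 * x + y) / 2) := by
  choose g hg using hmaps
  have hbij' : Function.Bijective fun p : ℕ × ℕ => g p.1 p.2 := by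
    refine ⟨fun p q hpq => (hbij (g q.1 q.2)).unique ?_ (hg _ _), fun n => ?_⟩
    · rw [hg]; exact_mod_cast hpq
    · obtain ⟨p, hp, -⟩ := hbij n
      exact ⟨p, by rw [hg] at hp; exact_mod_cast hp⟩
  have hval : ∀ x y : ℕ, (g x y : ℝ) = a * x ^ 2 + b * x * y + c * y ^ 2 + d * x + e * y + f :=
    fun x y => by rw [← hg, hF]
  have h00 := hval 0 0
  have h10 := hval 1 0
  have h01 := hval 0 1
  have h11 := hval 1 1
  have h20 := hval 2 0
  have h02 := hval 0 2
  push_cast at h00 h10 h01 h11 h20 h02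
  obtain ⟨A, B, C, D, E, f', h⟩ : ∃ A B C D E f' : ℤ,
      IsQuadraticPacking A B C D E f' (Equiv.ofBijective _ hbij') := by
    refine ⟨g 2 0 - 2 * g 1 0 + g 0 0, g 1 1 - g 1 0 - g 0 1 + g 0 0, g 0 2 - 2 * g 0 1 + g 0 0,
      4 * g 1 0 - 3 * g 0 0 - g 2 0, 4 * g 0 1 - 3 * g 0 0 - g 0 2, 2 * g 0 0, fun x y => ?_⟩
    rw [Equiv.ofBijective_apply, ← Int.cast_inj (α := ℝ)]
    push_cast
    rw [hval, h00, h10, h01, h11, h20, h02]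
    ring
  obtain ⟨rfl, rfl, rfl, rfl, hDE⟩ := h.coeff_eq
  refine hDE.imp ?_ ?_ <;>
  · rintro ⟨rfl, rfl⟩ x y
    have := congrArg (Int.cast (R := ℝ)) (h x y)
    rw [Equiv.ofBijective_apply] at this
    push_cast at this
    rw [hg]
    linarith
end
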